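/- arXiv:2403.09644 — 5 statements merged into one kernel-verified Lean document; each statement's English description precedes it below -/
import Mathlib

section
/- For every real number x with x ≥ 25, the inequality 15x/16 > (√x + 1)·(ln x)/(2·ln 2) holds. -/
/-- The tangent-line bound for `log` at `4`, with the slope relaxed using `2 / 3 < log 2`. -/
theorem log_le_linear_mul_log_two {s : ℝ} (hs : 4 ≤ s) :
    Real.log s ≤ (1 / 2 + 3 / 8 * s) * Real.log 2 := by
  have hlog4 : Real.log 4 = 2 * Real.log 2 := by
    rw [show (4 : ℝ) = 2 ^ 2 by norm_num, Real.log_pow]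
    norm_num
  have hdiv : Real.log (s / 4) = Real.log s - Real.log 4 :=
    Real.log_div (by linarith) (by norm_num)
  have htangent : Real.log (s / 4) ≤ s / 4 - 1 := Real.log_le_sub_one_of_pos (by linarith)
  nlinarith [Real.log_two_gt_d9]

theorem stmt_0 (x : ℝ) (hx : 25 ≤ x) :
    15 * x / 16 > (Real.sqrt x + 1) * Real.log x / (2 * Real.log 2) := by
  have hlog2 : 0 < Real.log 2 := Real.log_pos (by norm_num)
  have hs : 5 ≤ Real.sqrt x := Real.le_sqrt_of_sq_le (by linarith)
  have hsq : Real.sqrt x ^ 2 = x := Real.sq_sqrt (by linarith)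
  have hlog : Real.log x = 2 * Real.log (Real.sqrt x) := by
    rw [Real.log_sqrt (by linarith)]
    ring
  have hbound := log_le_linear_mul_log_two (s := Real.sqrt x) (by linarith)
  rw [gt_iff_lt, div_lt_iff₀ (by positivity), hlog]
  calc (Real.sqrt x + 1) * (2 * Real.log (Real.sqrt x))
      ≤ (Real.sqrt x + 1) * (2 * ((1 / 2 + 3 / 8 * Real.sqrt x) * Real.log 2)) := by gcongr
    _ = (Real.sqrt x + 1) * (1 / 2 + 3 / 8 * Real.sqrt x) * (2 * Real.log 2) := by ring
    _ < 15 * x / 16 * (2 * Real.log 2) := by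
      gcongr
      nlinarith
end

section
/- For all real numbers p and n with 3 ≤ p and p ≤ √n, the inequality (n/p − 1)·(ln p)/(ln n) ≥ (√n − 1)/2 holds. -/
theorem stmt_1 (p n : ℝ) (hp : 3 ≤ p) (hpn : p ≤ Real.sqrt n) :
    (n / p - 1) * Real.log p / Real.log n ≥ (Real.sqrt n - 1) / 2 := by
  have hp0 : 0 < p := by linarith
  have hs0 : 0 < Real.sqrt n := hp0.trans_le hpn
  obtain ⟨t, ht⟩ : ∃ t, Real.sqrt n = p * t := ⟨Real.sqrt n / p, by field_simp⟩
  have ht1 : 1 ≤ t := by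
    rw [ht] at hpn
    exact (le_mul_iff_one_le_right hp0).mp hpn
  have hn : n = (p * t) ^ 2 := by
    rw [← ht, Real.sq_sqrt (Real.sqrt_pos.mp hs0).le]
  have hlogp : 1 ≤ Real.log p := by
    rw [Real.le_log_iff_exp_le hp0]
    linarith [Real.exp_one_lt_d9]
  have hlogt : Real.log t ≤ t - 1 := Real.log_le_sub_one_of_pos (by linarith)
  have hlogt0 : 0 ≤ Real.log t := Real.log_nonneg ht1
  have hlogn : Real.log n = 2 * (Real.log p + Real.log t) := by
    rw [hn, Real.log_pow, Real.log_mul hp0.ne' (by linarith)]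
    norm_num
  have hdiv : n / p = p * t ^ 2 := by
    rw [hn]
    field_simp
  have hpt : 0 ≤ p * t - 1 := by nlinarith
  have key : (p * t - 1) * Real.log t ≤ p * t * (t - 1) * Real.log p :=
    calc (p * t - 1) * Real.log t ≤ (p * t - 1) * (t - 1) := by gcongr
      _ ≤ p * t * (t - 1) * 1 := by linarith
      _ ≤ p * t * (t - 1) * Real.log p := by
        have : 0 ≤ t - 1 := by linarith
        gcongr
  rw [ge_iff_le, hlogn, hdiv, ht, le_div_iff₀ (by linarith)]
  linarith
end

section
/- Let c ≥ 1 and let n be a positive integer with n ≥ (2c+3)². If n is not of the form (c+1)·p for a prime p, then e_{n−1−c}(n) ≡ 0 (mod n). -/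
/-- `esymm k n` is the sum of the products of all `k`-element subsets of `{1, …, n-1}`. -/
def esymm (k n : ℕ) : ℕ :=
  ∑ S ∈ (Finset.Icc 1 (n - 1)).powersetCard k, ∏ i ∈ S, i

open Polynomial

/-- A subset of `{1, …, p * m - 1}` missing only `c` elements contains at least `m - 1 - c`
multiples of `p`. -/
theorem pow_dvd_esymm_of_add_le {p m a c : ℕ} (hp : 0 < p) (hm : a + c + 1 ≤ m) :
    p ^ a ∣ esymm (p * m - 1 - c) (p * m) := by
  refine Finset.dvd_sum fun S hS => ?_
  obtain ⟨hsub, hcard⟩ := Finset.mem_powersetCard.1 hS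
  set T := (Finset.Icc 1 (m - 1)).image (p * ·) with hT
  have hTcard : T.card = m - 1 := by
    rw [hT, Finset.card_image_of_injective _ (mul_right_injective₀ hp.ne')]
    simp
  have hTsub : T ⊆ Finset.Icc 1 (p * m - 1) := by
    intro x hx
    obtain ⟨i, hi, rfl⟩ := Finset.mem_image.1 hx
    rw [Finset.mem_Icc] at hi ⊢
    have h1 : p * i < p * m := Nat.mul_lt_mul_of_pos_left (by omega) hp
    have h2 : 0 < p * i := Nat.mul_pos hp (by omega)
    omega
  have hunion : (S ∪ T).card ≤ p * m - 1 := by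
    simpa using Finset.card_le_card (Finset.union_subset hsub hTsub)
  have hle : m ≤ p * m := Nat.le_mul_of_pos_left m hp
  have hinter : a ≤ (S ∩ T).card := by
    have := Finset.card_union_add_card_inter S T
    omega
  calc p ^ a ∣ p ^ (S ∩ T).card := pow_dvd_pow p hinter
    _ = ∏ _i ∈ S ∩ T, p := by simp
    _ ∣ ∏ i ∈ S ∩ T, i := Finset.prod_dvd_prod_of_dvd _ _ fun i hi => by
        obtain ⟨j, -, rfl⟩ := Finset.mem_image.1 (Finset.mem_inter.1 hi).2
        exact dvd_mul_right p j
    _ ∣ ∏ i ∈ S, i := Finset.prod_dvd_prod_of_subset _ _ _ Finset.inter_subset_left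

theorem ZMod.prod_range_X_add_C (p : ℕ) [Fact p.Prime] :
    ∏ i ∈ Finset.range p, (X + C (i : ZMod p)) = X ^ p - X := by
  have hcard : ∏ a : ZMod p, (X - C a) = X ^ p - X := by
    have hroots := FiniteField.roots_X_pow_card_sub_X (ZMod p)
    have hdeg := FiniteField.X_pow_card_sub_X_natDegree_eq (ZMod p) (Fact.out : p.Prime).one_lt
    rw [ZMod.card] at hroots
    have hmonic : (X ^ p - X : (ZMod p)[X]).Monic :=
      monic_X_pow_sub (by simpa using (Fact.out : p.Prime).one_lt)
    have := prod_multiset_X_sub_C_of_monic_of_roots_card_eq hmonic (by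
      rw [hroots, hdeg, ← Finset.card_def, Finset.card_univ, ZMod.card])
    rwa [hroots] at this
  rw [← hcard, ← Equiv.prod_comp (Equiv.neg (ZMod p))]
  refine Finset.prod_nbij' (fun i => (i : ZMod p)) ZMod.val (by simp)
    (fun a _ => Finset.mem_range.2 a.val_lt)
    (fun i hi => ZMod.val_cast_of_lt (Finset.mem_range.1 hi)) (by simp) (by simp)

theorem ZMod.prod_range_mul_X_add_C (p m : ℕ) [Fact p.Prime] :
    ∏ i ∈ Finset.range (p * m), (X + C (i : ZMod p)) = (X ^ p - X) ^ m := by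
  induction m with
  | zero => simp
  | succ m ih =>
    rw [Nat.mul_succ, Finset.prod_range_add, ih, pow_succ]
    simp [← ZMod.prod_range_X_add_C]

theorem prod_range_X_add_C_coeff_succ {R : Type*} [CommRing R] {n c : ℕ} (hc : c < n) :
    (∏ i ∈ Finset.range n, (X + C (i : R))).coeff (c + 1) = (esymm (n - 1 - c) n : R) := by
  have hrange : Finset.range n = insert 0 (Finset.Icc 1 (n - 1)) := by
    ext i
    simp only [Finset.mem_range, Finset.mem_insert, Finset.mem_Icc]
    omega
  rw [hrange, Finset.prod_insert (by simp), Nat.cast_zero, C_0, add_zero, coeff_X_mul,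
    Finset.prod_X_add_C_coeff _ _ (by simp; omega)]
  simp [esymm]

theorem X_pow_sub_X_pow_coeff_eq_zero {R : Type*} [CommRing R] {p m k : ℕ} (hm : 0 < m)
    (hmk : m < k) (hkp : k < p) : ((X ^ p - X : R[X]) ^ m).coeff k = 0 := by
  have hexp : (X ^ p - X : R[X]) ^ m = expand R (p - 1) ((X - 1) ^ m) * X ^ m := by
    rw [map_pow, ← mul_pow, map_sub, expand_X, map_one, sub_mul, one_mul, ← pow_succ,
      Nat.sub_add_cancel (by omega)]
  rw [hexp, coeff_mul_X_pow', if_pos hmk.le, coeff_expand (by omega), if_neg]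
  exact Nat.not_dvd_of_pos_of_lt (by omega) (by omega)

theorem prime_dvd_esymm_of_le {p m c : ℕ} (hp : p.Prime) (hm : 0 < m) (hmc : m ≤ c)
    (hcp : c + 1 < p) : p ∣ esymm (p * m - 1 - c) (p * m) := by
  have := Fact.mk hp
  have hle : p ≤ p * m := Nat.le_mul_of_pos_right p hm
  rw [← ZMod.natCast_eq_zero_iff, ← prod_range_X_add_C_coeff_succ (by omega),
    ZMod.prod_range_mul_X_add_C]
  exact X_pow_sub_X_pow_coeff_eq_zero hm (by omega) hcp

theorem add_le_of_pow_dvd {p m a c : ℕ} (hp : 2 ≤ p) (ha : 2 ≤ a)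
    (hn : (2 * c + 3) ^ 2 ≤ p * m) (hdvd : p ^ a ∣ p * m) : a + c + 1 ≤ m := by
  obtain ⟨b, rfl⟩ := Nat.exists_eq_add_of_le' ha
  have hm : 0 < m := by
    rcases Nat.eq_zero_or_pos m with rfl | h
    · simp at hn
    · exact h
  have hdvd' : p ^ (b + 1) ∣ m :=
    Nat.dvd_of_mul_dvd_mul_left (k := p) (by omega) (by rwa [← pow_succ'])
  have hle : p ^ (b + 1) ≤ m := Nat.le_of_dvd hm hdvd'
  have hpm : p ≤ m := (Nat.le_self_pow (by omega) p).trans hle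
  have hcm : 2 * c + 3 ≤ m := by
    refine (Nat.pow_le_pow_iff_left two_ne_zero).1 (hn.trans ?_)
    rw [sq]
    exact Nat.mul_le_mul_right m hpm
  have h2 : 2 ^ (b + 1) ≤ m := (Nat.pow_le_pow_left hp _).trans hle
  have hb := b.lt_two_pow_self
  rw [pow_succ] at h2
  omega

theorem stmt_2 (c n : ℕ) (hc : 1 ≤ c) (hn : (2 * c + 3) ^ 2 ≤ n)
    (hnp : ¬ ∃ p : ℕ, p.Prime ∧ n = (c + 1) * p) :
    esymm (n - 1 - c) n ≡ 0 [MOD n] := by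
  rw [Nat.modEq_zero_iff_dvd, Nat.dvd_iff_prime_pow_dvd_dvd]
  intro p a hp hdvd
  rcases Nat.eq_zero_or_pos a with rfl | ha
  · simp
  obtain ⟨m, rfl⟩ := (dvd_pow_self p ha.ne').trans hdvd
  rcases Nat.lt_or_ge 1 a with ha' | ha'
  · exact pow_dvd_esymm_of_add_le hp.pos (add_le_of_pow_dvd hp.two_le ha' hn hdvd)
  obtain rfl : a = 1 := by omega
  rcases Nat.lt_or_ge (c + 1) m with hm | hm
  · exact pow_dvd_esymm_of_add_le hp.pos (by omega)
  have hmne : m ≠ c + 1 := fun h => hnp ⟨p, hp, by rw [h, mul_comm]⟩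
  have hmpos : 0 < m := by
    rcases Nat.eq_zero_or_pos m with rfl | h
    · simp at hn
    · exact h
  rw [pow_one]
  refine prime_dvd_esymm_of_le hp hmpos (by omega) ?_
  by_contra! hpc
  have := Nat.mul_le_mul hpc hm
  nlinarith
end

section
/- Let p be a prime, let c ≥ 1 and n ≥ (2c+3)², and suppose p^a exactly divides n (i.e. p^a ∣ n and p^{a+1} ∤ n) with a ≥ 2. Then for every subset S of {1, 2, …, n−1} with |S| = n−1−c, the product Π_{i ∈ S} i is divisible by p^a. -/
theorem Finset.pow_card_dvd_prod {ι M : Type*} [CommMonoid M] (s : Finset ι) (f : ι → M) (b : M)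
    (h : ∀ i ∈ s, b ∣ f i) : b ^ s.card ∣ ∏ i ∈ s, f i := by
  rw [← Finset.prod_const]
  exact Finset.prod_dvd_prod_of_dvd _ _ h

/-- If `p ^ (b + 2) * m` is at least `(2 * c + 3) ^ 2`, then its quotient by `p` exceeds
`b + 2 + c`. -/
theorem add_lt_pow_mul_of_sq_le {p b m c : ℕ} (hp : 2 ≤ p) (hm : 0 < m) (hc : 1 ≤ c)
    (hn : (2 * c + 3) ^ 2 ≤ p ^ (b + 2) * m) : b + 2 + c < p ^ (b + 1) * m := by
  have hsq : p ^ (b + 2) * m ≤ (p ^ (b + 1) * m) ^ 2 := by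
    rw [mul_pow, ← pow_mul]
    exact Nat.mul_le_mul (Nat.pow_le_pow_right (by omega) (by omega))
      (Nat.le_self_pow (by omega) m)
  have hk : 2 * c + 3 ≤ p ^ (b + 1) * m :=
    (Nat.pow_le_pow_iff_left (by omega)).mp (hn.trans hsq)
  have hpow : 2 ^ (b + 1) ≤ p ^ (b + 1) * m :=
    (Nat.pow_le_pow_left hp _).trans (Nat.le_mul_of_pos_right _ hm)
  have hb : ∀ d, 2 ≤ d → 2 * d + 3 ≤ 2 ^ (d + 1) := by
    intro d hd
    induction d, hd using Nat.le_induction with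
    | base => norm_num
    | succ d hd ih => rw [pow_succ]; omega
  by_cases h : 2 ≤ b
  · have := hb b h
    omega
  · omega

theorem stmt_3 (p n c a : ℕ) (hp : p.Prime) (hc : 1 ≤ c) (hn : (2 * c + 3) ^ 2 ≤ n)
    (hpa : p ^ a ∣ n) (hpa' : ¬ p ^ (a + 1) ∣ n) (ha : 2 ≤ a)
    (S : Finset ℕ) (hS : S ⊆ Finset.Icc 1 (n - 1)) (hcard : S.card = n - 1 - c) :
    p ^ a ∣ ∏ i ∈ S, i := by
  obtain ⟨b, rfl⟩ := Nat.exists_eq_add_of_le' ha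
  obtain ⟨m, rfl⟩ := hpa
  have hm : 0 < m := by
    rcases Nat.eq_zero_or_pos m with rfl | h
    · simp at hpa'
    · exact h
  have hk := add_lt_pow_mul_of_sq_le hp.two_le hm hc hn
  have hnk : p ^ (b + 2) * m = p * (p ^ (b + 1) * m) := by ring
  rw [hnk] at hn hS hcard
  generalize p ^ (b + 1) * m = k at *
  have hinj : Function.Injective (p * ·) := fun x y h => Nat.eq_of_mul_eq_mul_left hp.pos h
  let M := (Finset.Icc 1 (k - 1)).image (p * ·)
  have hMcard : M.card = k - 1 := by
    rw [Finset.card_image_of_injective _ hinj, Nat.card_Icc]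
    omega
  have hM : M ⊆ Finset.Icc 1 (p * k - 1) := by
    intro x hx
    obtain ⟨y, hy, rfl⟩ := Finset.mem_image.mp hx
    rw [Finset.mem_Icc] at hy ⊢
    have h₁ : p * y < p * k := Nat.mul_lt_mul_of_pos_left (by omega) hp.pos
    have h₂ : 0 < p * y := Nat.mul_pos hp.pos (by omega)
    omega
  have hunion := Finset.card_le_card (Finset.union_subset hM hS)
  rw [Nat.card_Icc] at hunion
  have hadd := Finset.card_union_add_card_inter M S
  have hle : k ≤ p * k := Nat.le_mul_of_pos_left k hp.pos
  calc p ^ (b + 2) ∣ p ^ (M ∩ S).card := pow_dvd_pow p (by omega)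
    _ ∣ ∏ i ∈ M ∩ S, i := by
      refine Finset.pow_card_dvd_prod _ _ _ fun i hi => ?_
      obtain ⟨y, -, rfl⟩ := Finset.mem_image.mp (Finset.mem_inter.mp hi).1
      exact Dvd.intro y rfl
    _ ∣ ∏ i ∈ S, i := Finset.prod_dvd_prod_of_subset _ _ _ Finset.inter_subset_right
end

section
/- Let p be an odd prime dividing n with p ≤ √n, and let c ≥ 1 with n ≥ (2c+3)². Let x be the unique integer with p^x ≤ n < p^{x+1}. Then the p-adic valuation of (n−1)! is at least (c+1)·x; equivalently, p^{(c+1)x} divides (n−1)!. -/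
theorem pow_dvd_factorial_mul {p : ℕ} (hp : 0 < p) (j : ℕ) : p ^ j ∣ (p * j).factorial := by
  induction j with
  | zero => simp
  | succ j ih =>
    rw [pow_succ, Nat.mul_succ]
    exact (mul_dvd_mul ih (Nat.dvd_factorial hp le_rfl)).trans
      (Nat.factorial_mul_factorial_dvd_factorial_add _ _)

theorem add_two_sq_le_four_mul_pow {p : ℕ} (hp : 3 ≤ p) (j : ℕ) : (j + 2) ^ 2 ≤ 4 * p ^ j := by
  induction j with
  | zero => simp
  | succ j ih =>
    have h : p ^ j * 3 ≤ p ^ (j + 1) := by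
      rw [pow_succ]
      gcongr
    calc (j + 1 + 2) ^ 2 ≤ (j + 1 + 2) ^ 2 + (2 * j ^ 2 + 6 * j + 3) := Nat.le_add_right _ _
      _ = (j + 2) ^ 2 * 3 := by ring
      _ ≤ 4 * p ^ j * 3 := by gcongr
      _ = 4 * (p ^ j * 3) := by ring
      _ ≤ 4 * p ^ (j + 1) := by gcongr

theorem stmt_4 (p n c x : ℕ) (hp : p.Prime) (hodd : Odd p) (hpn : p ∣ n)
    (hsqrt : (p : ℝ) ≤ Real.sqrt n) (hc : 1 ≤ c) (hn : (2 * c + 3) ^ 2 ≤ n)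
    (hx1 : p ^ x ≤ n) (hx2 : n < p ^ (x + 1)) :
    p ^ ((c + 1) * x) ∣ Nat.factorial (n - 1) := by
  have hp3 : 3 ≤ p := by
    have := hp.two_le
    rcases hodd with ⟨k, rfl⟩
    omega
  have hp2 : p ^ 2 ≤ n := by
    have h := (Real.le_sqrt' (by exact_mod_cast hp.pos)).mp hsqrt
    exact_mod_cast h
  have hx : 2 ≤ x := by
    have := (Nat.pow_lt_pow_iff_right hp.one_lt).mp (hp2.trans_lt hx2)
    omega
  obtain ⟨m, rfl⟩ := hpn
  have hxn : (p * x) ^ 2 ≤ 4 * (p * m) := by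
    obtain ⟨j, rfl⟩ := Nat.exists_eq_add_of_le' hx
    calc (p * (j + 2)) ^ 2 = p ^ 2 * (j + 2) ^ 2 := by ring
      _ ≤ p ^ 2 * (4 * p ^ j) := by
        gcongr
        exact add_two_sq_le_four_mul_pow hp3 j
      _ = 4 * p ^ (j + 2) := by ring
      _ ≤ 4 * (p * m) := by gcongr
  have hm : x * (2 * c + 3) ≤ 2 * m := by
    have h : (p * (x * (2 * c + 3))) ^ 2 ≤ (p * (2 * m)) ^ 2 := by
      calc (p * (x * (2 * c + 3))) ^ 2 = (p * x) ^ 2 * (2 * c + 3) ^ 2 := by ring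
        _ ≤ 4 * (p * m) * (p * m) := Nat.mul_le_mul hxn hn
        _ = (p * (2 * m)) ^ 2 := by ring
    exact Nat.le_of_mul_le_mul_left ((Nat.pow_le_pow_iff_left two_ne_zero).mp h) hp.pos
  have hm1 : (c + 1) * x + 1 ≤ m := by nlinarith
  refine (pow_dvd_factorial_mul hp.pos _).trans (Nat.factorial_dvd_factorial ?_)
  have : p * ((c + 1) * x + 1) ≤ p * m := by gcongr
  rw [mul_add] at this
  omega
end
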